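/- Suppose the truthful profile (every agent reports the ranking x_1, x_2, …, x_n, listing objects in decreasing order of fundamental value) is a Nash equilibrium of the game induced by the Boston mechanism, where each agent's payoff is their expected utility over the mechanism's uniformly random ordering. Then the truthful profile is also a Nash equilibrium of the game induced by the random serial dictatorship. -/

import Mathlib

/-- The object in the earliest position of report `P` (a bijection from
positions to objects) among objects not in `S`. -/
def topPick {n : ℕ} [NeZero n] (P : Equiv.Perm (Fin n)) (S : Finset (Fin n)) : Fin n :=
  if h : (Finset.univ.filter fun p => P p ∉ S).Nonempty then
    P ((Finset.univ.filter fun p => P p ∉ S).min' h)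
  else 0

/-- Objects assigned by the serial dictatorship (with reports `R` and
ordering `π`, both position-indexed) to the agents in the first `k` positions. -/
def sdAssigned {n : ℕ} [NeZero n] (R : Fin n → Equiv.Perm (Fin n))
    (π : Equiv.Perm (Fin n)) : ℕ → Finset (Fin n)
  | 0 => ∅
  | k + 1 =>
    if h : k < n then
      sdAssigned R π k ∪ {topPick (R (π ⟨k, h⟩)) (sdAssigned R π k)}
    else sdAssigned R π k

/-- Serial dictatorship allocation: given reports `R` (for each agent, a bijection
position → object) and an ordering `π` (position → agent), agent `i` receives the object
in the earliest position of their own report among the objects not assigned to the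
agents in earlier positions of `π`. -/
def sdAlloc {n : ℕ} [NeZero n] (R : Fin n → Equiv.Perm (Fin n))
    (π : Equiv.Perm (Fin n)) (i : Fin n) : Fin n :=
  topPick (R i) (sdAssigned R π (π.symm i : ℕ))

/-- The partial assignment (agent → assigned object, if any) after `k` rounds of the
Boston mechanism with reports `R` and tiebreak ordering `π` (position → agent).
In round `k+1`, every unassigned agent `i` points to the object in position `k` of their
report, and receives it iff it is unassigned and `i` is earliest in `π` among the
unassigned agents pointing to it. -/
def bostonRounds {n : ℕ} [NeZero n] (R : Fin n → Equiv.Perm (Fin n))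
    (π : Equiv.Perm (Fin n)) : ℕ → Fin n → Option (Fin n)
  | 0 => fun _ => none
  | k + 1 =>
    if h : k < n then
      fun i =>
        match bostonRounds R π k i with
        | some x => some x
        | none =>
          if (∀ j, bostonRounds R π k j ≠ some (R i ⟨k, h⟩)) ∧
              (∀ j, bostonRounds R π k j = none → R j ⟨k, h⟩ = R i ⟨k, h⟩ →
                (π.symm i : ℕ) ≤ (π.symm j : ℕ)) then
            some (R i ⟨k, h⟩)
          else none
    else bostonRounds R π k

/-- The Boston-mechanism allocation (after all `n` rounds). -/
def bostonAlloc {n : ℕ} [NeZero n] (R : Fin n → Equiv.Perm (Fin n))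
    (π : Equiv.Perm (Fin n)) (i : Fin n) : Fin n :=
  (bostonRounds R π n i).getD 0

/-- Expected utility of agent `i` under the random serial dictatorship (uniform over
the `n !` orderings), where receiving the object in position `j` of one's own report
yields utility `v x + ρ j`. -/
noncomputable def rsdEU {n : ℕ} [NeZero n] (v ρ : Fin n → ℝ)
    (R : Fin n → Equiv.Perm (Fin n)) (i : Fin n) : ℝ :=
  (∑ π : Equiv.Perm (Fin n), (v (sdAlloc R π i) + ρ ((R i).symm (sdAlloc R π i)))) /
    (Nat.factorial n)

/-- Expected utility of agent `i` under the Boston mechanism with uniformly random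
tiebreak ordering. -/
noncomputable def bostonEU {n : ℕ} [NeZero n] (v ρ : Fin n → ℝ)
    (R : Fin n → Equiv.Perm (Fin n)) (i : Fin n) : ℝ :=
  (∑ π : Equiv.Perm (Fin n), (v (bostonAlloc R π i) + ρ ((R i).symm (bostonAlloc R π i)))) /
    (Nat.factorial n)
/-- The preference assumption: all agents share common fundamental values over the
objects `x_1, …, x_n` (object `x_j` is `(j-1 : Fin n)`), with
`v x_1 > v x_2 > v x_3 = v x_4 = ⋯ = v x_n`. -/
def prefAssumption {n : ℕ} (v : Fin n → ℝ) : Prop :=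
  (∀ j k : Fin n, j < k → (j : ℕ) < 2 → v k < v j) ∧
    (∀ j k : Fin n, 2 ≤ (j : ℕ) → 2 ≤ (k : ℕ) → v j = v k)

/-- `R` is a Nash equilibrium of the game induced by the random serial dictatorship:
no agent can strictly increase their expected utility by a unilateral deviation. -/
def rsdNash {n : ℕ} [NeZero n] (v ρ : Fin n → ℝ) (R : Fin n → Equiv.Perm (Fin n)) : Prop :=
  ∀ (i : Fin n) (P' : Equiv.Perm (Fin n)),
    rsdEU v ρ (Function.update R i P') i ≤ rsdEU v ρ R i

/-- `R` is a Nash equilibrium of the game induced by the Boston mechanism. -/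
def bostonNash {n : ℕ} [NeZero n] (v ρ : Fin n → ℝ) (R : Fin n → Equiv.Perm (Fin n)) : Prop :=
  ∀ (i : Fin n) (P' : Equiv.Perm (Fin n)),
    bostonEU v ρ (Function.update R i P') i ≤ bostonEU v ρ R i

theorem exists_topPick_eq {n : ℕ} [NeZero n] (P : Equiv.Perm (Fin n)) {S : Finset (Fin n)}
    {x : Fin n} (hx : x ∉ S) :
    ∃ p, topPick P S = P p ∧ P p ∉ S ∧ ∀ q < p, P q ∈ S := by
  have h : (Finset.univ.filter fun p => P p ∉ S).Nonempty :=
    ⟨P.symm x, by simpa using hx⟩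
  refine ⟨(Finset.univ.filter fun p => P p ∉ S).min' h, by simp [topPick, h], ?_, ?_⟩
  · simpa using Finset.min'_mem _ h
  · intro q hq
    by_contra hqS
    exact absurd (Finset.min'_le _ q (by simpa using hqS)) (not_le.mpr hq)

theorem topPick_eq_apply {n : ℕ} [NeZero n] {P : Equiv.Perm (Fin n)} {S : Finset (Fin n)}
    {p : Fin n} (hp : P p ∉ S) (hlt : ∀ q < p, P q ∈ S) : topPick P S = P p := by
  obtain ⟨p', h, hp', hlt'⟩ := exists_topPick_eq P hp
  obtain hpp | rfl | hpp := lt_trichotomy p p'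
  · exact absurd (hlt' p hpp) hp
  · exact h
  · exact absurd (hlt p' hpp) hp'

/-- When everyone but `i` is truthful, the agents preceding `i` take the objects in order. -/
theorem sdAssigned_update_refl {n : ℕ} [NeZero n] (π P : Equiv.Perm (Fin n)) (i : Fin n) :
    ∀ k ≤ (π.symm i : ℕ),
      sdAssigned (Function.update (fun _ => Equiv.refl (Fin n)) i P) π k =
        Finset.univ.filter fun x : Fin n => (x : ℕ) < k := by
  intro k
  induction k with
  | zero => simp [sdAssigned]
  | succ k ih =>
    intro hk
    have hkn : k < n := by omega
    have hne : π ⟨k, hkn⟩ ≠ i := by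
      rintro rfl
      simp at hk
    have htop : topPick (Equiv.refl (Fin n)) (Finset.univ.filter fun x : Fin n => (x : ℕ) < k) =
        ⟨k, hkn⟩ :=
      topPick_eq_apply (P := Equiv.refl (Fin n)) (p := ⟨k, hkn⟩) (by simp)
        fun q hq => by simpa [Fin.lt_def] using hq
    rw [sdAssigned, dif_pos hkn, ih (by omega), Function.update_of_ne hne, htop]
    ext x
    simp only [Finset.mem_union, Finset.mem_filter, Finset.mem_univ, true_and,
      Finset.mem_singleton, Fin.ext_iff]
    omega

theorem sdAlloc_update_refl {n : ℕ} [NeZero n] (π P : Equiv.Perm (Fin n)) (i : Fin n) :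
    sdAlloc (Function.update (fun _ => Equiv.refl (Fin n)) i P) π i =
      topPick P (Finset.univ.filter fun x => x < π.symm i) := by
  rw [sdAlloc, sdAssigned_update_refl π P i _ le_rfl, Function.update_self]
  rfl

theorem sdAlloc_refl {n : ℕ} [NeZero n] (π : Equiv.Perm (Fin n)) (i : Fin n) :
    sdAlloc (fun _ => Equiv.refl (Fin n)) π i = π.symm i := by
  have h := sdAlloc_update_refl π (Equiv.refl (Fin n)) i
  rw [Function.update_eq_self_iff.mpr rfl] at h
  rw [h]
  exact topPick_eq_apply (P := Equiv.refl (Fin n)) (by simp) fun q hq => by simpa using hq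

/-- The first `k` rounds of the Boston mechanism depend only on the first `k` positions of the
reports. -/
theorem bostonRounds_congr {n : ℕ} [NeZero n] {R R' : Fin n → Equiv.Perm (Fin n)}
    (π : Equiv.Perm (Fin n)) {k : ℕ} (h : ∀ j, ∀ p : Fin n, (p : ℕ) < k → R j p = R' j p) :
    bostonRounds R π k = bostonRounds R' π k := by
  induction k with
  | zero => rfl
  | succ k ih =>
    have ih := ih fun j p hp => h j p (by omega)
    by_cases hk : k < n
    · have hR : ∀ j, R j ⟨k, hk⟩ = R' j ⟨k, hk⟩ := fun j => h j _ (by simp)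
      simp only [bostonRounds, dif_pos hk, ih, hR]
    · simp only [bostonRounds, dif_neg hk, ih]

theorem bostonRounds_refl {n : ℕ} [NeZero n] (π : Equiv.Perm (Fin n)) {k : ℕ} (hk : k ≤ n)
    (j : Fin n) :
    bostonRounds (fun _ => Equiv.refl (Fin n)) π k j =
      if (π.symm j : ℕ) < k then some (π.symm j) else none := by
  induction k generalizing j with
  | zero => simp [bostonRounds]
  | succ k ih =>
    have hkn : k < n := hk
    simp only [bostonRounds, dif_pos hkn, ih hkn.le, Equiv.refl_apply]
    obtain hj | hj | hj := lt_trichotomy (π.symm j : ℕ) k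
    · simp [hj, hj.trans (Nat.lt_succ_self k)]
    · have hjk : π.symm j = ⟨k, hkn⟩ := Fin.ext hj
      rw [if_neg (show ¬(π.symm j : ℕ) < k by omega), if_pos (show (π.symm j : ℕ) < k + 1 by omega),
        hjk]
      dsimp only
      refine if_pos ⟨fun l => ?_, fun l hl _ => ?_⟩
      · split_ifs with hl
        · simp only [ne_eq, Option.some.injEq, Fin.ext_iff]
          omega
        · simp
      · by_contra hlt
        rw [if_pos (by simpa using hlt)] at hl
        simp at hl
    · rw [if_neg (show ¬(π.symm j : ℕ) < k by omega),
        if_neg (show ¬(π.symm j : ℕ) < k + 1 by omega)]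
      dsimp only
      refine if_neg fun h => ?_
      have := h.2 (π ⟨k, hkn⟩) (by simp) trivial
      simp only [Equiv.symm_apply_apply] at this
      omega

theorem bostonAlloc_refl {n : ℕ} [NeZero n] (π : Equiv.Perm (Fin n)) (i : Fin n) :
    bostonAlloc (fun _ => Equiv.refl (Fin n)) π i = π.symm i := by
  simp [bostonAlloc, bostonRounds_refl π le_rfl]

theorem bostonRounds_eq_some_of_le {n : ℕ} [NeZero n] {R : Fin n → Equiv.Perm (Fin n)}
    {π : Equiv.Perm (Fin n)} {i x : Fin n} {k l : ℕ} (hkl : k ≤ l)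
    (h : bostonRounds R π k i = some x) : bostonRounds R π l i = some x := by
  induction l, hkl using Nat.le_induction with
  | base => exact h
  | succ l _ ih =>
    by_cases hl : l < n
    · simp [bostonRounds, hl, ih]
    · simp [bostonRounds, hl, ih]

theorem bostonAlloc_eq_of_bostonRounds {n : ℕ} [NeZero n] {R : Fin n → Equiv.Perm (Fin n)}
    {π : Equiv.Perm (Fin n)} {i x : Fin n} {k : ℕ} (hk : k ≤ n)
    (h : bostonRounds R π k i = some x) : bostonAlloc R π i = x := by
  simp [bostonAlloc, bostonRounds_eq_some_of_le hk h]

/-- An agent who swaps two adjacent objects `k` and `k + 1` in an otherwise truthful profile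
secures object `k + 1` in round `k` of the Boston mechanism, unless assigned earlier. -/
theorem bostonAlloc_update_swap {n : ℕ} [NeZero n] (π : Equiv.Perm (Fin n)) (i : Fin n)
    {k l : Fin n} (hkl : (l : ℕ) = k + 1) :
    bostonAlloc (Function.update (fun _ => Equiv.refl (Fin n)) i (Equiv.swap k l)) π i =
      if π.symm i < k then π.symm i else l := by
  have hne : k ≠ l := fun h => by simp [h] at hkl
  have hk : ∀ j, bostonRounds (Function.update (fun _ => Equiv.refl (Fin n)) i (Equiv.swap k l))
      π k j = if (π.symm j : ℕ) < k then some (π.symm j) else none := by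
    intro j
    rw [← bostonRounds_refl π k.is_lt.le]
    refine congrFun (bostonRounds_congr π fun j p hp => ?_) j
    obtain rfl | hj := eq_or_ne j i
    · rw [Function.update_self]
      exact Equiv.swap_apply_of_ne_of_ne (by rintro rfl; omega) (by rintro rfl; omega)
    · rw [Function.update_of_ne hj]
  split_ifs with hi
  · exact bostonAlloc_eq_of_bostonRounds k.is_lt.le ((hk i).trans (if_pos hi))
  · refine bostonAlloc_eq_of_bostonRounds (k := k + 1) k.is_lt ?_
    simp only [bostonRounds, dif_pos k.is_lt, hk, Function.update_self, Equiv.swap_apply_left]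
    rw [if_neg (by simpa using hi)]
    refine if_pos ⟨fun j => ?_, fun j _ hj => ?_⟩
    · split_ifs with hj
      · simp only [ne_eq, Option.some.injEq, Fin.ext_iff]
        omega
      · simp
    · obtain rfl | hji := eq_or_ne j i
      · exact le_rfl
      · rw [Function.update_of_ne hji] at hj
        exact absurd hj hne

theorem prefAssumption.antitone {n : ℕ} {v : Fin n → ℝ} (hv : prefAssumption v) :
    Antitone v := by
  intro j k hjk
  obtain rfl | hlt := hjk.eq_or_lt
  · exact le_rfl
  · by_cases hj : (j : ℕ) < 2
    · exact (hv.1 j k hlt hj).le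
    · exact (hv.2 k j (by simp only [Fin.lt_def] at hlt; omega) (by omega)).le

/-- If `k` is the first position at which the report `P` differs from the truthful one, then
deviating to `P` under serial dictatorship yields, for each ordering, at most what swapping
`k` and `k + 1` yields under the Boston mechanism. -/
theorem sdAlloc_utility_le_bostonAlloc_utility {n : ℕ} [NeZero n] {v ρ : Fin n → ℝ}
    (hρ : Antitone ρ) (hv : Antitone v) (π : Equiv.Perm (Fin n)) (i : Fin n)
    {P : Equiv.Perm (Fin n)} {k l : Fin n} (hkl : (l : ℕ) = k + 1)
    (hfix : ∀ p < k, P p = p) (hk : k < P k) :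
    v (sdAlloc (Function.update (fun _ => Equiv.refl (Fin n)) i P) π i) +
        ρ (P.symm (sdAlloc (Function.update (fun _ => Equiv.refl (Fin n)) i P) π i)) ≤
      v (bostonAlloc (Function.update (fun _ => Equiv.refl (Fin n)) i (Equiv.swap k l)) π i) +
        ρ ((Equiv.swap k l).symm
          (bostonAlloc (Function.update (fun _ => Equiv.refl (Fin n)) i (Equiv.swap k l)) π i)) := by
  rw [sdAlloc_update_refl, bostonAlloc_update_swap π i hkl]
  split_ifs with hi
  · have htop : topPick P (Finset.univ.filter fun x => x < π.symm i) = P (π.symm i) :=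
      topPick_eq_apply (by simp [hfix _ hi])
        fun q hq => by simpa [hfix q (hq.trans hi)] using hq
    have hswap : Equiv.swap k l (π.symm i) = π.symm i :=
      Equiv.swap_apply_of_ne_of_ne hi.ne (by rw [ne_eq, Fin.ext_iff]; omega)
    have hP : P.symm (π.symm i) = π.symm i := P.symm_apply_eq.mpr (hfix _ hi).symm
    simp [htop, hfix _ hi, hswap, hP]
  · obtain ⟨p, htop, hp, hlt⟩ :=
      exists_topPick_eq P (x := π.symm i) (S := Finset.univ.filter fun x => x < π.symm i) (by simp)
    simp only [Finset.mem_filter, Finset.mem_univ, true_and, not_lt] at hp hlt hi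
    have hkp : k ≤ p := by
      by_contra! h
      exact absurd (hfix p h ▸ hp) (not_le.mpr (h.trans_le hi))
    have hlp : l ≤ P p := by
      suffices k < P p by simp only [Fin.lt_def, Fin.le_def] at *; omega
      obtain rfl | h := hkp.eq_or_lt
      · exact hk
      · exact (hk.trans (hlt k h)).trans_le hp
    rw [htop, Equiv.symm_apply_apply, Equiv.symm_swap, Equiv.swap_apply_right]
    exact add_le_add (hv hlp) (hρ hkp)

theorem exists_first_not_fixed {n : ℕ} {P : Equiv.Perm (Fin n)} (hP : P ≠ Equiv.refl (Fin n)) :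
    ∃ k, (∀ p < k, P p = p) ∧ k < P k := by
  obtain ⟨k, hk, hmin⟩ := WellFounded.has_min (wellFounded_lt (α := Fin n)) {k | P k ≠ k} (by
    by_contra h
    rw [Set.not_nonempty_iff_eq_empty, Set.eq_empty_iff_forall_notMem] at h
    exact hP (Equiv.ext fun p => by simpa using h p))
  have hfix : ∀ p < k, P p = p := fun p hp => by
    by_contra h
    exact hmin p h hp
  refine ⟨k, hfix, (lt_or_gt_of_ne hk).resolve_left fun h => hk ?_⟩
  exact P.injective (hfix _ h)

/-- Under the preference assumption, if the truthful profile (every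
agent reports the ranking `x_1, x_2, …, x_n`, i.e. the identity bijection, listing the
objects in decreasing order of fundamental value) is a Nash equilibrium of the Boston
mechanism, then it is also a Nash equilibrium of the random serial dictatorship. -/
theorem truthful_boston_equilibrium_implies_truthful_rsd_equilibrium
    (n : ℕ) [NeZero n] (v ρ : Fin n → ℝ) (hρ : Antitone ρ) (hv : prefAssumption v)
    (hB : bostonNash v ρ fun _ => Equiv.refl (Fin n)) :
    rsdNash v ρ fun _ => Equiv.refl (Fin n) := by
  intro i P
  by_cases hP : P = Equiv.refl (Fin n)
  · rw [hP, Function.update_eq_self_iff.mpr rfl]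
  · obtain ⟨k, hfix, hk⟩ := exists_first_not_fixed hP
    have hkn : (k : ℕ) + 1 < n := lt_of_le_of_lt hk (P k).is_lt
    have htruth : bostonEU v ρ (fun _ => Equiv.refl (Fin n)) i =
        rsdEU v ρ (fun _ => Equiv.refl (Fin n)) i := by
      simp only [bostonEU, rsdEU, bostonAlloc_refl, sdAlloc_refl]
    refine le_trans ?_ ((hB i (Equiv.swap k ⟨k + 1, hkn⟩)).trans_eq htruth)
    unfold rsdEU bostonEU
    refine div_le_div_of_nonneg_right (Finset.sum_le_sum fun π _ => ?_) (Nat.cast_nonneg _)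
    simp only [Function.update_self]
    exact sdAlloc_utility_le_bostonAlloc_utility hρ hv.antitone π i rfl hfix hk
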